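/- arXiv:2401.05045 — 5 statements merged into one kernel-verified Lean document; each statement's English description precedes it below -/
import Mathlib

section
/- Let A > 0 and λ ≥ 0 with A + λ < e, and let P_{X*} be a capacity-achieving input distribution of the amplitude-constrained discrete-time Poisson channel. Then the support of P_{X*} has exactly two points, namely supp(P_{X*}) = {0, A}. -/
open MeasureTheory Real Set

noncomputable section

/-- Poisson transition pmf with dark current `lam`:
`P_{Y|X}(y|x) = (x+lam)^y e^{-(x+lam)} / y!` (with the convention `0^0 = 1`). -/
def channelPMF (lam x : ℝ) (y : ℕ) : ℝ :=
  (x + lam) ^ y * Real.exp (-(x + lam)) / (Nat.factorial y)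

/-- Output pmf induced by the input distribution `μ`. -/
def outputPMF (lam : ℝ) (μ : Measure ℝ) (y : ℕ) : ℝ :=
  ∫ x, channelPMF lam x y ∂μ

/-- Kullback–Leibler divergence between pmfs on `ℕ` (natural logarithm). -/
def klDiv (p q : ℕ → ℝ) : ℝ :=
  ∑' y, p y * Real.log (p y / q y)

/-- The function `i(x; μ) = D(P_{Y|X}(·|x) ‖ P_Y^μ)`. -/
def iFun (lam : ℝ) (μ : Measure ℝ) (x : ℝ) : ℝ :=
  klDiv (channelPMF lam x) (outputPMF lam μ)

/-- Mutual information for input distribution `μ`. -/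
def mutualInfo (lam : ℝ) (μ : Measure ℝ) : ℝ :=
  ∫ x, iFun lam μ x ∂μ

/-- Admissible input distributions: probability measures supported in `[0, A]`. -/
def IsInput (A : ℝ) (μ : Measure ℝ) : Prop :=
  IsProbabilityMeasure μ ∧ μ (Set.Icc 0 A)ᶜ = 0

/-- The capacity `C(A, lam)` of the amplitude-constrained Poisson channel. -/
def capacity (A lam : ℝ) : ℝ :=
  sSup (mutualInfo lam '' {μ : Measure ℝ | IsInput A μ})

/-- A capacity-achieving input distribution. -/
def IsCapacityAchieving (A lam : ℝ) (μ : Measure ℝ) : Prop :=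
  IsInput A μ ∧ mutualInfo lam μ = capacity A lam

/-- Topological support of a measure on `ℝ`. -/
def msupport (μ : Measure ℝ) : Set ℝ :=
  {x | ∀ U : Set ℝ, IsOpen U → x ∈ U → 0 < μ U}

/-- The mean of `c` under the Poisson distribution with parameter `t`. -/
def poissonMean (c : ℕ → ℝ) (t : ℝ) : ℝ :=
  Real.exp (-t) * ∑' y, c y * t ^ y / (Nat.factorial y)

lemma summable_of_geometric_bound {c : ℕ → ℝ} {K R : ℝ} (hc : ∀ y, |c y| ≤ K * R ^ y) (t : ℝ) :
    Summable fun y => c y * t ^ y / (Nat.factorial y) := by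
  refine Summable.of_norm_bounded ((Real.summable_pow_div_factorial (R * |t|)).mul_left K) ?_
  intro y
  rw [norm_div, norm_mul, norm_pow, Real.norm_eq_abs, Real.norm_eq_abs, Real.norm_natCast, mul_pow,
    mul_div_assoc', ← mul_assoc]
  gcongr
  exact hc y

lemma hasSum_poissonMean {c : ℕ → ℝ} {K R : ℝ} (hc : ∀ y, |c y| ≤ K * R ^ y) (t : ℝ) :
    HasSum (fun y => c y * (t ^ y * Real.exp (-t)) / (Nat.factorial y)) (poissonMean c t) := by
  have := (summable_of_geometric_bound hc t).hasSum.mul_left (Real.exp (-t))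
  refine this.congr_fun ?_
  intro y
  ring

lemma hasDerivAt_tsum_pow_div_factorial {c : ℕ → ℝ} {K R : ℝ} (hR : 0 ≤ R)
    (hc : ∀ y, |c y| ≤ K * R ^ y) (t : ℝ) :
    HasDerivAt (fun s => ∑' y, c y * s ^ y / (Nat.factorial y))
      (∑' y, c (y + 1) * t ^ y / (Nat.factorial y)) t := by
  have hK : 0 ≤ K := by simpa using (abs_nonneg _).trans (hc 0)
  set r := |t| + 1 with hr
  have hshift : ∀ s : ℝ, ∀ y : ℕ,
      c (y + 1) * (((y + 1 : ℕ) : ℝ) * s ^ y) / (Nat.factorial (y + 1))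
        = c (y + 1) * s ^ y / (Nat.factorial y) := by
    intro s y
    have : (Nat.factorial y : ℝ) ≠ 0 := by positivity
    rw [Nat.factorial_succ]
    push_cast
    field_simp
  have hu : Summable fun y : ℕ => K * R ^ y * (y * r ^ (y - 1)) / (Nat.factorial y) := by
    rw [← summable_nat_add_iff 1]
    have := (Real.summable_pow_div_factorial (R * r)).mul_left (K * R)
    refine this.congr fun y => ?_
    have h : (Nat.factorial y : ℝ) ≠ 0 := by positivity
    rw [Nat.factorial_succ, Nat.add_sub_cancel, mul_pow, pow_succ]
    push_cast
    field_simp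
  have key := hasDerivAt_tsum_of_isPreconnected (g := fun y s => c y * s ^ y / (Nat.factorial y))
    (g' := fun y s => c y * (y * s ^ (y - 1)) / (Nat.factorial y)) (t := Metric.ball (0 : ℝ) r)
    (y₀ := t) (y := t) hu Metric.isOpen_ball (convex_ball _ _).isPreconnected
    (fun y s _ => ((hasDerivAt_pow y s).const_mul (c y)).div_const _)
    (fun y s hs => by
      have hs' : |s| ≤ r := by simpa using (Metric.mem_ball.1 hs).le
      rw [norm_div, norm_mul, norm_mul, norm_pow, Real.norm_natCast, Real.norm_natCast,
        Real.norm_eq_abs, Real.norm_eq_abs]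
      gcongr
      exact hc y)
    (by simp [hr]) (summable_of_geometric_bound hc t) (by simp [hr])
  refine key.congr_deriv ?_
  have hs : Summable fun y : ℕ => c y * (y * t ^ (y - 1)) / (Nat.factorial y) := by
    refine Summable.of_norm_bounded hu fun y => ?_
    rw [norm_div, norm_mul, norm_mul, norm_pow, Real.norm_natCast, Real.norm_natCast,
      Real.norm_eq_abs, Real.norm_eq_abs]
    gcongr
    · exact hc y
    · simp [hr]
  rw [hs.tsum_eq_zero_add]
  simp only [Nat.cast_zero, zero_mul, mul_zero, zero_div, zero_add, Nat.add_sub_cancel]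
  exact tsum_congr (hshift t)

lemma abs_shift_le {c : ℕ → ℝ} {K R : ℝ} (hc : ∀ y, |c y| ≤ K * R ^ y) (y : ℕ) :
    |c (y + 1)| ≤ K * R * R ^ y := by
  rw [mul_assoc, ← pow_succ']
  exact hc _

lemma abs_diff_le {c : ℕ → ℝ} {K R : ℝ} (hc : ∀ y, |c y| ≤ K * R ^ y) (y : ℕ) :
    |c (y + 1) - c y| ≤ (K * R + K) * R ^ y := by
  rw [add_mul]
  exact (abs_sub _ _).trans (add_le_add (abs_shift_le hc y) (hc y))

lemma poissonMean_sub {c d : ℕ → ℝ} {K L R : ℝ} (hc : ∀ y, |c y| ≤ K * R ^ y)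
    (hd : ∀ y, |d y| ≤ L * R ^ y) (t : ℝ) :
    poissonMean (fun y => c y - d y) t = poissonMean c t - poissonMean d t := by
  unfold poissonMean
  rw [← mul_sub, ← (summable_of_geometric_bound hc t).tsum_sub (summable_of_geometric_bound hd t)]
  congr 1
  exact tsum_congr fun y => by ring

lemma hasDerivAt_poissonMean {c : ℕ → ℝ} {K R : ℝ} (hR : 0 ≤ R)
    (hc : ∀ y, |c y| ≤ K * R ^ y) (t : ℝ) :
    HasDerivAt (poissonMean c) (poissonMean (fun y => c (y + 1) - c y) t) t := by
  have h := ((hasDerivAt_neg t).exp).mul (hasDerivAt_tsum_pow_div_factorial hR hc t)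
  rw [poissonMean_sub (abs_shift_le hc) (L := K) hc]
  refine h.congr_deriv ?_
  unfold poissonMean
  ring

lemma poissonMean_const (a t : ℝ) : poissonMean (fun _ => a) t = a := by
  unfold poissonMean
  have h : HasSum (fun y : ℕ => t ^ y / (Nat.factorial y)) (Real.exp t) := by
    rw [Real.exp_eq_exp_ℝ]
    exact NormedSpace.expSeries_div_hasSum_exp t
  simp_rw [mul_div_assoc]
  rw [tsum_mul_left, h.tsum_eq, mul_left_comm, ← Real.exp_add]
  simp

lemma poissonMean_le {c : ℕ → ℝ} {K R : ℝ} (hc : ∀ y, |c y| ≤ K * R ^ y) {a t : ℝ} (ht : 0 ≤ t)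
    (h : ∀ y, c y ≤ a) : poissonMean c t ≤ a := by
  rw [← poissonMean_const a t]
  refine hasSum_le (fun y => ?_) (hasSum_poissonMean hc t)
    (hasSum_poissonMean (K := |a|) (R := 1) (by simp) t)
  gcongr
  exact h y

/-- The information density at intensity `t` of an input whose output moments have logarithms `g`. -/
def intensityInfo (g : ℕ → ℝ) (t : ℝ) : ℝ :=
  t * Real.log t - t - poissonMean g t

lemma continuous_poissonMean {c : ℕ → ℝ} {K R : ℝ} (hR : 0 ≤ R)
    (hc : ∀ y, |c y| ≤ K * R ^ y) : Continuous (poissonMean c) :=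
  continuous_iff_continuousAt.2 fun t => (hasDerivAt_poissonMean hR hc t).continuousAt

lemma continuous_intensityInfo {g : ℕ → ℝ} {K R : ℝ} (hR : 0 ≤ R)
    (hg : ∀ y, |g y| ≤ K * R ^ y) : Continuous (intensityInfo g) :=
  (Real.continuous_mul_log.sub continuous_id).sub (continuous_poissonMean hR hg)

lemma not_isLocalMax_intensityInfo {g : ℕ → ℝ} {K R b t : ℝ} (hR : 0 ≤ R)
    (hg : ∀ y, |g y| ≤ K * R ^ y) (hb : ∀ y, g (y + 1) - g y ≤ Real.log b)
    (hb0 : 0 < b) (hbe : b < Real.exp 1) (ht : 0 < t) :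
    ¬ IsLocalMax (intensityInfo g) t := by
  intro hmax
  have hf := abs_diff_le hg
  have hd : ∀ s : ℝ, 0 < s → HasDerivAt (intensityInfo g)
      (Real.log s - poissonMean (fun y => g (y + 1) - g y) s) s := by
    intro s hs
    refine (((Real.hasDerivAt_mul_log hs.ne').sub (hasDerivAt_id s)).sub
      (hasDerivAt_poissonMean hR hg s)).congr_deriv ?_
    ring
  have hev : deriv (intensityInfo g) =ᶠ[nhds t]
      fun s => Real.log s - poissonMean (fun y => g (y + 1) - g y) s := by
    filter_upwards [lt_mem_nhds ht] with s hs using (hd s hs).deriv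
  have h0 : deriv (intensityInfo g) t = 0 := hmax.deriv_eq_zero
  have h1 : Real.log t = poissonMean (fun y => g (y + 1) - g y) t := by
    rw [(hd t ht).deriv] at h0
    linarith
  have h2 : deriv (deriv (intensityInfo g)) t > 0 := by
    have hdd := (Real.hasDerivAt_log ht.ne').fun_sub (hasDerivAt_poissonMean hR hf t)
    rw [hev.deriv_eq, hdd.deriv, poissonMean_sub (abs_shift_le hf) hf, ← h1]
    have hle := poissonMean_le (abs_shift_le hf) ht.le (fun y => hb (y + 1))
    have hlog : Real.log (b / t / Real.exp 1) ≤ b / t / Real.exp 1 - 1 :=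
      Real.log_le_sub_one_of_pos (by positivity)
    rw [Real.log_div (by positivity) (by positivity), Real.log_div hb0.ne' ht.ne',
      Real.log_exp] at hlog
    have : b / t / Real.exp 1 < t⁻¹ := by
      rw [div_div, div_lt_iff₀ (by positivity)]
      field_simp
      exact hbe
    linarith
  have hmin := isLocalMin_of_deriv_deriv_pos h2 h0 (hd t ht).continuousAt
  have hconst : intensityInfo g =ᶠ[nhds t] fun _ => intensityInfo g t := by
    filter_upwards [hmin, hmax] with s h1 h2 using le_antisymm h2 h1
  have h3 : deriv (deriv (intensityInfo g)) t = 0 := by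
    rw [hconst.deriv.deriv_eq]
    simp
  exact h2.ne' h3

lemma poissonMean_natCast (t : ℝ) : poissonMean (fun y => (y : ℝ)) t = t := by
  have h : HasSum (fun y : ℕ => t ^ y / (Nat.factorial y)) (Real.exp t) := by
    rw [Real.exp_eq_exp_ℝ]
    exact NormedSpace.expSeries_div_hasSum_exp t
  have h' : HasSum (fun y : ℕ => (y : ℝ) * t ^ y / (Nat.factorial y)) (t * Real.exp t) := by
    rw [← hasSum_nat_add_iff' 1]
    simp only [Finset.range_one, Finset.sum_singleton, Nat.cast_zero, zero_mul, zero_div, sub_zero]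
    refine (h.mul_left t).congr_fun fun y => ?_
    have : (Nat.factorial y : ℝ) ≠ 0 := by positivity
    rw [Nat.factorial_succ, pow_succ]
    push_cast
    field_simp
  unfold poissonMean
  rw [h'.tsum_eq, mul_left_comm, ← Real.exp_add]
  simp

lemma natCast_le_two_pow (y : ℕ) : |(y : ℝ)| ≤ 1 * 2 ^ y := by
  rw [Nat.abs_cast, one_mul]
  exact_mod_cast Nat.lt_two_pow_self.le

/-- The unnormalised Poisson weight `(x + lam) ^ y * exp (-(x + lam))`. -/
def weight (lam x : ℝ) (y : ℕ) : ℝ :=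
  (x + lam) ^ y * Real.exp (-(x + lam))

/-- The average of the unnormalised Poisson weight under `μ`. -/
def moment (lam : ℝ) (μ : Measure ℝ) (y : ℕ) : ℝ :=
  ∫ x, weight lam x y ∂μ

lemma channelPMF_eq (lam x : ℝ) (y : ℕ) :
    channelPMF lam x y = weight lam x y / (Nat.factorial y) := rfl

lemma outputPMF_eq (lam : ℝ) (μ : Measure ℝ) (y : ℕ) :
    outputPMF lam μ y = moment lam μ y / (Nat.factorial y) := by
  unfold outputPMF moment
  simp_rw [channelPMF_eq]
  exact integral_div _ _

lemma continuous_weight (lam : ℝ) (y : ℕ) : Continuous fun x => weight lam x y := by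
  unfold weight
  fun_prop

section Input

variable {A lam : ℝ} {μ : Measure ℝ}

lemma weight_nonneg (hlam : 0 ≤ lam) {x : ℝ} (hx : 0 ≤ x) (y : ℕ) : 0 ≤ weight lam x y := by
  unfold weight
  positivity

lemma weight_le (hlam : 0 ≤ lam) (hAe : A + lam ≤ Real.exp 1) {x : ℝ} (hx : x ∈ Icc 0 A)
    (y : ℕ) : weight lam x y ≤ Real.exp 1 ^ y := by
  unfold weight
  have h0 : 0 ≤ x + lam := add_nonneg hx.1 hlam
  calc _ ≤ Real.exp 1 ^ y * 1 := by
        gcongr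
        · linarith [hx.2]
        · exact Real.exp_le_one_iff.2 (by linarith)
    _ = _ := mul_one _

lemma IsInput.ae_mem (hμ : IsInput A μ) : ∀ᵐ x ∂μ, x ∈ Icc 0 A := hμ.2

lemma IsInput.integrable (hμ : IsInput A μ) {f : ℝ → ℝ} (hf : Continuous f) : Integrable f μ := by
  have := hμ.1
  rw [← Measure.restrict_eq_self_of_ae_mem hμ.ae_mem]
  exact hf.continuousOn.integrableOn_compact isCompact_Icc

lemma moment_nonneg (hlam : 0 ≤ lam) (hμ : IsInput A μ) (y : ℕ) : 0 ≤ moment lam μ y :=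
  integral_nonneg_of_ae (hμ.ae_mem.mono fun _ hx => weight_nonneg hlam hx.1 y)

lemma moment_le (hlam : 0 ≤ lam) (hAe : A + lam ≤ Real.exp 1) (hμ : IsInput A μ) (y : ℕ) :
    moment lam μ y ≤ Real.exp 1 ^ y := by
  have := hμ.1
  calc moment lam μ y ≤ ∫ _, Real.exp 1 ^ y ∂μ :=
        integral_mono_ae (hμ.integrable (continuous_weight lam y)) (integrable_const _)
          (hμ.ae_mem.mono fun _ hx => weight_le hlam hAe hx y)
    _ = _ := by simp

lemma moment_succ_le (hlam : 0 ≤ lam) (hμ : IsInput A μ) (y : ℕ) :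
    moment lam μ (y + 1) ≤ (A + lam) * moment lam μ y := by
  unfold moment
  rw [← integral_const_mul]
  refine integral_mono_ae (hμ.integrable (continuous_weight lam _))
    ((hμ.integrable (continuous_weight lam y)).const_mul _) (hμ.ae_mem.mono fun x hx => ?_)
  have h := mul_le_mul_of_nonneg_right (add_le_add_left hx.2 lam) (weight_nonneg hlam hx.1 y)
  refine le_trans (le_of_eq ?_) h
  unfold weight
  ring

lemma moment_zero_pos (lam : ℝ) (hμ : IsInput A μ) : 0 < moment lam μ 0 := by
  have := hμ.1
  have h := integral_exp_pos (μ := μ) (f := fun x => -(x + lam))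
    (hμ.integrable (by fun_prop))
  simpa [moment, weight] using h

lemma moment_geometric_le (hlam : 0 ≤ lam) (hμ : IsInput A μ) (h1 : 0 < moment lam μ 1) (y : ℕ) :
    moment lam μ 0 * (moment lam μ 1 / moment lam μ 0) ^ y ≤ moment lam μ y := by
  have h0 := moment_zero_pos lam hμ
  set c := moment lam μ 1 / moment lam μ 0 with hc
  have hcpos : 0 < c := by positivity
  have i0 := hμ.integrable (continuous_weight lam 0)
  have i1 := hμ.integrable (continuous_weight lam 1)
  have hle : ∫ x, (c ^ y * (1 - y) * weight lam x 0 + c ^ y * (y / c) * weight lam x 1) ∂μ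
      ≤ moment lam μ y := by
    refine integral_mono_ae ((i0.const_mul _).add (i1.const_mul _))
      (hμ.integrable (continuous_weight lam y)) (hμ.ae_mem.mono fun x hx => ?_)
    have ht : 0 ≤ x + lam := add_nonneg hx.1 hlam
    have hb := one_add_mul_le_pow (a := (x + lam) / c - 1)
      (by have : 0 ≤ (x + lam) / c := by positivity
          linarith) y
    rw [add_sub_cancel, div_pow, le_div_iff₀ (by positivity)] at hb
    have hb' := mul_le_mul_of_nonneg_right hb (Real.exp_pos (-(x + lam))).le
    refine le_trans (le_of_eq ?_) hb'
    simp only [weight]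
    ring
  rw [integral_add (i0.const_mul _) (i1.const_mul _), integral_const_mul,
    integral_const_mul] at hle
  refine le_trans (le_of_eq ?_) hle
  change _ = c ^ y * (1 - y) * moment lam μ 0 + c ^ y * (y / c) * moment lam μ 1
  have : moment lam μ 1 = c * moment lam μ 0 := by rw [hc]; field_simp
  rw [this]
  field_simp
  ring

lemma moment_eq_zero_iff (hlam : 0 ≤ lam) (hμ : IsInput A μ) (y : ℕ) :
    moment lam μ y = 0 ↔ ∀ᵐ x ∂μ, weight lam x y = 0 :=
  integral_eq_zero_iff_of_nonneg_ae (hμ.ae_mem.mono fun _ hx => weight_nonneg hlam hx.1 y)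
    (hμ.integrable (continuous_weight lam y))

lemma weight_eq_zero {x : ℝ} {y : ℕ} (h : weight lam x y = 0) : x + lam = 0 ∧ y ≠ 0 := by
  unfold weight at h
  exact pow_eq_zero_iff'.1 ((mul_eq_zero.1 h).resolve_right (Real.exp_pos _).ne')

lemma weight_eq_zero_of_add_eq_zero {x : ℝ} {y : ℕ} (h : x + lam = 0) (hy : y ≠ 0) :
    weight lam x y = 0 := by
  simp [weight, h, hy]

lemma exists_abs_log_moment_le (hlam : 0 ≤ lam) (hAe : A + lam ≤ Real.exp 1)
    (hμ : IsInput A μ) : ∃ K : ℝ, ∀ y, |Real.log (moment lam μ y)| ≤ K * 2 ^ y := by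
  have h0 := moment_zero_pos lam hμ
  rcases (moment_nonneg hlam hμ 1).eq_or_lt with h1 | h1
  · refine ⟨|Real.log (moment lam μ 0)|, fun y => ?_⟩
    rcases eq_or_ne y 0 with rfl | hy
    · simp
    · have : moment lam μ y = 0 := by
        rw [moment_eq_zero_iff hlam hμ]
        filter_upwards [(moment_eq_zero_iff hlam hμ 1).1 h1.symm] with x hx
        exact weight_eq_zero_of_add_eq_zero (weight_eq_zero hx).1 hy
      rw [this, Real.log_zero, abs_zero]
      positivity
  · set c := moment lam μ 1 / moment lam μ 0
    have hc : 0 < c := by positivity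
    refine ⟨|Real.log (moment lam μ 0)| + |Real.log c| + 1, fun y => ?_⟩
    have hlow := moment_geometric_le hlam hμ h1 y
    have hpos : 0 < moment lam μ y := lt_of_lt_of_le (by positivity) hlow
    have hl := Real.log_le_log (by positivity) hlow
    have hu := Real.log_le_log hpos (moment_le hlam hAe hμ y)
    rw [Real.log_mul h0.ne' (by positivity), Real.log_pow] at hl
    rw [Real.log_pow, Real.log_exp, mul_one] at hu
    have hy : (y : ℝ) ≤ 2 ^ y := by exact_mod_cast Nat.lt_two_pow_self.le
    have hy1 : (1 : ℝ) ≤ 2 ^ y := one_le_pow₀ (by norm_num)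
    have hy0 : (0 : ℝ) ≤ y := y.cast_nonneg
    have e1 : |Real.log (moment lam μ 0)| ≤ |Real.log (moment lam μ 0)| * 2 ^ y :=
      le_mul_of_one_le_right (abs_nonneg _) hy1
    have e2 : y * |Real.log c| ≤ |Real.log c| * 2 ^ y := by
      rw [mul_comm]
      gcongr
    have e3 := neg_abs_le (Real.log (moment lam μ 0))
    have e4 : -(y * |Real.log c|) ≤ y * Real.log c := by
      rw [← mul_neg]
      exact mul_le_mul_of_nonneg_left (neg_abs_le _) hy0
    have e5 := abs_nonneg (Real.log (moment lam μ 0))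
    have e6 := mul_nonneg hy0 (abs_nonneg (Real.log c))
    rw [abs_le]
    constructor <;> nlinarith

lemma hasSum_mul_moment (hlam : 0 ≤ lam) (hAe : A + lam ≤ Real.exp 1) (hμ : IsInput A μ)
    {c : ℕ → ℝ} {K R : ℝ} (hc : ∀ y, |c y| ≤ K * R ^ y) :
    HasSum (fun y => c y * moment lam μ y / (Nat.factorial y))
      (∫ x, poissonMean c (x + lam) ∂μ) := by
  have h := hasSum_integral_of_summable_integral_norm (μ := μ)
    (F := fun y x => c y * weight lam x y / (Nat.factorial y))
    (fun y => ((hμ.integrable (continuous_weight lam y)).const_mul _).div_const _) ?_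
  · have e : ∀ x, ∑' y, c y * weight lam x y / (Nat.factorial y) = poissonMean c (x + lam) :=
      fun x => (hasSum_poissonMean hc (x + lam)).tsum_eq
    simp_rw [e] at h
    refine h.congr_fun fun y => ?_
    rw [integral_div, integral_const_mul]
    rfl
  · refine Summable.of_nonneg_of_le (fun y => integral_nonneg fun _ => norm_nonneg _) (fun y => ?_)
      ((Real.summable_pow_div_factorial (R * Real.exp 1)).mul_left K)
    have e : ∫ x, ‖c y * weight lam x y / (Nat.factorial y)‖ ∂μ
        = |c y| * moment lam μ y / (Nat.factorial y) := by
      unfold moment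
      rw [← integral_const_mul, ← integral_div]
      refine integral_congr_ae (hμ.ae_mem.mono fun x hx => ?_)
      simp only [norm_div, norm_mul, Nat.abs_cast, Real.norm_eq_abs,
        abs_of_nonneg (weight_nonneg hlam hx.1 y)]
    rw [e, mul_pow, mul_div_assoc', ← mul_assoc]
    have h1 := moment_le hlam hAe hμ y
    have h2 := moment_nonneg hlam hμ y
    gcongr
    · exact (abs_nonneg _).trans (hc y)
    · exact hc y

lemma iFun_eq_intensityInfo {K R : ℝ}
    (hg : ∀ y, |Real.log (moment lam μ y)| ≤ K * R ^ y) {x : ℝ}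
    (hz : ∀ y, moment lam μ y = 0 → weight lam x y = 0) :
    iFun lam μ x = intensityInfo (fun y => Real.log (moment lam μ y)) (x + lam) := by
  have s1 := (hasSum_poissonMean natCast_le_two_pow (x + lam)).mul_left (Real.log (x + lam))
  have s2 := hasSum_poissonMean (c := fun _ => x + lam) (K := |x + lam|) (R := 1)
    (by simp) (x + lam)
  have s3 := hasSum_poissonMean hg (x + lam)
  rw [poissonMean_natCast] at s1
  rw [poissonMean_const] at s2
  have s := (s1.sub s2).sub s3
  unfold iFun klDiv intensityInfo
  rw [mul_comm (x + lam), ← s.tsum_eq]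
  refine tsum_congr fun y => ?_
  rw [channelPMF_eq, outputPMF_eq, div_div_div_cancel_right₀ (by positivity)]
  change weight lam x y / _ * _ = Real.log (x + lam) * (y * weight lam x y / _)
    - (x + lam) * weight lam x y / _ - _ * weight lam x y / _
  by_cases hw : weight lam x y = 0
  · simp [hw]
  · rw [Real.log_div hw (fun h => hw (hz y h))]
    have : Real.log (weight lam x y) = y * Real.log (x + lam) - (x + lam) := by
      unfold weight at hw ⊢
      rw [Real.log_mul (left_ne_zero_of_mul hw) (Real.exp_pos _).ne', Real.log_pow, Real.log_exp]
      ring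
    rw [this]
    ring

lemma mutualInfo_eq_integral (hlam : 0 ≤ lam) (hAe : A + lam ≤ Real.exp 1) (hμ : IsInput A μ) :
    mutualInfo lam μ
      = ∫ x, intensityInfo (fun y => Real.log (moment lam μ y)) (x + lam) ∂μ := by
  obtain ⟨K, hg⟩ := exists_abs_log_moment_le hlam hAe hμ
  refine integral_congr_ae ?_
  have hz : ∀ᵐ x ∂μ, ∀ y, moment lam μ y = 0 → weight lam x y = 0 := by
    rw [ae_all_iff]
    intro y
    by_cases h : moment lam μ y = 0
    · filter_upwards [(moment_eq_zero_iff hlam hμ y).1 h] with x hx _ using hx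
    · exact Filter.Eventually.of_forall fun x h' => absurd h' h
  filter_upwards [hz] with x hz
  exact iFun_eq_intensityInfo hg hz

lemma continuous_energy (lam : ℝ) :
    Continuous fun x : ℝ => (x + lam) * Real.log (x + lam) - (x + lam) :=
  (Real.continuous_mul_log.comp (continuous_add_const lam)).sub (continuous_add_const lam)

lemma hasSum_moment_mul_log (hlam : 0 ≤ lam) (hAe : A + lam ≤ Real.exp 1) (hμ : IsInput A μ) :
    HasSum (fun y => moment lam μ y * Real.log (moment lam μ y) / (Nat.factorial y))
      (∫ x, ((x + lam) * Real.log (x + lam) - (x + lam)) ∂μ - mutualInfo lam μ) := by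
  obtain ⟨K, hg⟩ := exists_abs_log_moment_le hlam hAe hμ
  have h := hasSum_mul_moment hlam hAe hμ hg
  have hc : Continuous fun x => poissonMean (fun y => Real.log (moment lam μ y)) (x + lam) :=
    (continuous_poissonMean (by norm_num) hg).comp (continuous_add_const lam)
  rw [mutualInfo_eq_integral hlam hAe hμ]
  unfold intensityInfo
  rw [integral_sub (hμ.integrable (continuous_energy lam)) (hμ.integrable hc), sub_sub_cancel]
  simpa only [mul_comm (moment lam μ _)] using h

end Input

/-- The mixture of `μ` and a point mass at `x₀`, the latter with weight `ε`. -/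
def mixDirac (μ : Measure ℝ) (x₀ ε : ℝ) : Measure ℝ :=
  ENNReal.ofReal (1 - ε) • μ + ENNReal.ofReal ε • Measure.dirac x₀

section Capacity

variable {A lam : ℝ} {μ : Measure ℝ}

lemma isInput_dirac {x : ℝ} (hx : x ∈ Icc 0 A) : IsInput A (Measure.dirac x) := by
  refine ⟨inferInstance, ?_⟩
  rw [Measure.dirac_apply' _ measurableSet_Icc.compl]
  simp [hx]

lemma isInput_mixDirac (hμ : IsInput A μ) {x₀ ε : ℝ} (hx : x₀ ∈ Icc 0 A) (h0 : 0 ≤ ε)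
    (h1 : ε ≤ 1) : IsInput A (mixDirac μ x₀ ε) := by
  have := hμ.1
  refine ⟨⟨?_⟩, ?_⟩
  · simp only [mixDirac, Measure.add_apply, Measure.smul_apply, measure_univ, smul_eq_mul, mul_one]
    rw [← ENNReal.ofReal_add (by linarith) h0]
    simp
  · simp only [mixDirac, Measure.add_apply, Measure.smul_apply, hμ.2, (isInput_dirac hx).2,
      smul_zero, add_zero]

lemma integral_mixDirac (hμ : IsInput A μ) {x₀ ε : ℝ} (h0 : 0 ≤ ε)
    (h1 : ε ≤ 1) {f : ℝ → ℝ} (hf : Continuous f) :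
    ∫ x, f x ∂(mixDirac μ x₀ ε) = (1 - ε) * ∫ x, f x ∂μ + ε * f x₀ := by
  unfold mixDirac
  rw [integral_add_measure ((hμ.integrable hf).smul_measure ENNReal.ofReal_ne_top)
    ((integrable_dirac (by simp)).smul_measure ENNReal.ofReal_ne_top),
    integral_smul_measure, integral_smul_measure, integral_dirac,
    ENNReal.toReal_ofReal (by linarith), ENNReal.toReal_ofReal h0]
  rfl

lemma moment_mixDirac (hμ : IsInput A μ) {x₀ ε : ℝ} (h0 : 0 ≤ ε) (h1 : ε ≤ 1) (y : ℕ) :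
    moment lam (mixDirac μ x₀ ε) y = (1 - ε) * moment lam μ y + ε * weight lam x₀ y :=
  integral_mixDirac hμ h0 h1 (continuous_weight lam y)

lemma moment_dirac (x : ℝ) (y : ℕ) : moment lam (Measure.dirac x) y = weight lam x y :=
  integral_dirac _ _

lemma mutualInfo_dirac (x : ℝ) : mutualInfo lam (Measure.dirac x) = 0 := by
  unfold mutualInfo
  rw [integral_dirac]
  unfold iFun klDiv
  rw [← tsum_zero (α := ℝ) (β := ℕ)]
  refine tsum_congr fun y => ?_
  have : outputPMF lam (Measure.dirac x) y = channelPMF lam x y := integral_dirac _ _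
  rw [this]
  by_cases h : channelPMF lam x y = 0
  · simp [h]
  · simp [div_self h]

lemma hasSum_one_div_factorial :
    HasSum (fun y : ℕ => 1 / (Nat.factorial y : ℝ)) (Real.exp 1) := by
  rw [Real.exp_eq_exp_ℝ]
  simpa using NormedSpace.expSeries_div_hasSum_exp (1 : ℝ)

lemma mutualInfo_le (hlam : 0 ≤ lam) (hAe : A + lam ≤ Real.exp 1) (hμ : IsInput A μ) :
    mutualInfo lam μ ≤ Real.exp 1 := by
  have h := hasSum_moment_mul_log hlam hAe hμ
  have hle := hasSum_le (fun y => ?_) hasSum_one_div_factorial.neg h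
  · have : ∫ x, ((x + lam) * Real.log (x + lam) - (x + lam)) ∂μ ≤ 0 := by
      refine integral_nonpos_of_ae (hμ.ae_mem.mono fun x hx => ?_)
      have ht : 0 ≤ x + lam := add_nonneg hx.1 hlam
      have : Real.log (x + lam) ≤ 1 := by
        rcases ht.eq_or_lt with h | h
        · rw [← h, Real.log_zero]
          norm_num
        · rw [Real.log_le_iff_le_exp h]
          linarith [hx.2]
      simp only [Pi.zero_apply]
      nlinarith
    linarith
  · rw [← neg_div]
    gcongr
    rcases (moment_nonneg hlam hμ y).eq_or_lt with h | h
    · rw [← h]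
      norm_num
    · have h1 := Real.one_sub_inv_le_log_of_pos h
      have h2 := mul_le_mul_of_nonneg_left h1 h.le
      rw [mul_sub, mul_inv_cancel₀ h.ne'] at h2
      linarith

lemma mutualInfo_le_capacity (hlam : 0 ≤ lam) (hAe : A + lam ≤ Real.exp 1) (hμ : IsInput A μ) :
    mutualInfo lam μ ≤ capacity A lam := by
  refine le_csSup ⟨Real.exp 1, ?_⟩ ⟨μ, hμ, rfl⟩
  rintro _ ⟨ν, hν, rfl⟩
  exact mutualInfo_le hlam hAe hν

lemma capacity_pos (hA : 0 < A) (hlam : 0 ≤ lam) (hAe : A + lam ≤ Real.exp 1) :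
    0 < capacity A lam := by
  have m0 : (0 : ℝ) ∈ Icc 0 A := ⟨le_rfl, hA.le⟩
  have mA : A ∈ Icc 0 A := ⟨hA.le, le_rfl⟩
  have hmix := isInput_mixDirac (isInput_dirac m0) mA (ε := 1 / 2) (by norm_num) (by norm_num)
  refine lt_of_lt_of_le ?_ (mutualInfo_le_capacity hlam hAe hmix)
  have s := hasSum_moment_mul_log hlam hAe hmix
  have s0 := hasSum_moment_mul_log hlam hAe (isInput_dirac m0)
  have s1 := hasSum_moment_mul_log hlam hAe (isInput_dirac mA)
  rw [integral_mixDirac (isInput_dirac m0) (by norm_num) (by norm_num) (continuous_energy lam)] at s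
  simp only [moment_mixDirac (isInput_dirac m0) (x₀ := A) (ε := 1 / 2) (by norm_num) (by norm_num)]
    at s
  rw [mutualInfo_dirac] at s0 s1
  simp only [moment_dirac, integral_dirac, sub_zero] at s s0 s1
  have hconv := Real.strictConvexOn_mul_log
  have w0 : ∀ y, weight lam 0 y ∈ Ici (0 : ℝ) := weight_nonneg hlam le_rfl
  have wA : ∀ y, weight lam A y ∈ Ici (0 : ℝ) := weight_nonneg hlam hA.le
  have hlt := hasSum_lt (i := 0) (fun y => ?_) ?_ s ((s0.mul_left (1 / 2)).add (s1.mul_left (1 / 2)))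
  · linarith
  · have := hconv.convexOn.2 (w0 y) (wA y) (show (0 : ℝ) ≤ 1 / 2 by norm_num)
      (show (0 : ℝ) ≤ 1 / 2 by norm_num) (by norm_num)
    simp only [smul_eq_mul] at this
    simp only [mul_div_assoc', ← add_div]
    rw [show (1 : ℝ) - 1 / 2 = 1 / 2 by norm_num]
    gcongr
  · have hne : weight lam 0 0 ≠ weight lam A 0 := by
      simp only [weight, pow_zero, one_mul, ne_eq, Real.exp_eq_exp]
      intro h
      linarith
    have := hconv.2 (w0 0) (wA 0) hne (show (0 : ℝ) < 1 / 2 by norm_num)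
      (show (0 : ℝ) < 1 / 2 by norm_num) (by norm_num)
    simp only [smul_eq_mul] at this
    simp only [mul_div_assoc', ← add_div]
    rw [show (1 : ℝ) - 1 / 2 = 1 / 2 by norm_num]
    gcongr

lemma mul_log_mix_le {m w ε : ℝ} (hm : 0 < m) (hw : 0 ≤ w) (h0 : 0 ≤ ε) (h1 : ε < 1) :
    ((1 - ε) * m + ε * w) * Real.log ((1 - ε) * m + ε * w)
      ≤ (1 - ε) * (m * Real.log m) + ε * (Real.log m * w) + ε * (w - m)
        + ε ^ 2 * ((w - m) ^ 2 / m) := by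
  set u := (1 - ε) * m + ε * w with hu
  have hupos : 0 < u := by
    have : 0 < (1 - ε) * m := mul_pos (by linarith) hm
    positivity
  have h := mul_le_mul_of_nonneg_left (Real.log_le_sub_one_of_pos (div_pos hupos hm)) hupos.le
  rw [Real.log_div hupos.ne' hm.ne', mul_sub] at h
  refine (sub_le_iff_le_add.1 h).trans (le_of_eq ?_)
  rw [hu]
  field_simp
  ring

lemma summable_sq_sub_div_moment (hlam : 0 ≤ lam) (hAe : A + lam ≤ Real.exp 1) (hμ : IsInput A μ)
    (h1 : 0 < moment lam μ 1) {x₀ : ℝ} (hx : x₀ ∈ Icc 0 A) :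
    Summable fun y => (weight lam x₀ y - moment lam μ y) ^ 2 / moment lam μ y
      / (Nat.factorial y) := by
  have hm0 := moment_zero_pos lam hμ
  set c := moment lam μ 1 / moment lam μ 0 with hc
  have hcpos : 0 < c := by positivity
  refine Summable.of_nonneg_of_le (fun y => ?_) (fun y => ?_)
    ((Real.summable_pow_div_factorial (Real.exp 1 ^ 2 / c)).mul_left (1 / moment lam μ 0))
  · have := moment_nonneg hlam hμ y
    positivity
  · have hlow := moment_geometric_le hlam hμ h1 y
    have e1 := weight_le hlam hAe hx y
    have e2 := weight_nonneg hlam hx.1 y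
    have e3 := moment_le hlam hAe hμ y
    have e4 := moment_nonneg hlam hμ y
    have hsq : (weight lam x₀ y - moment lam μ y) ^ 2 ≤ (Real.exp 1 ^ y) ^ 2 := by
      rw [sq_le_sq, abs_of_pos (a := Real.exp 1 ^ y) (by positivity), abs_le]
      constructor <;> linarith
    rw [mul_div_assoc']
    gcongr
    calc _ ≤ (Real.exp 1 ^ y) ^ 2 / (moment lam μ 0 * c ^ y) := by gcongr
      _ = _ := by
        rw [div_pow (Real.exp 1 ^ 2), div_mul_div_comm, one_mul, ← pow_mul, ← pow_mul, mul_comm y 2]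

lemma intensityInfo_le_mutualInfo (hlam : 0 ≤ lam) (hAe : A + lam ≤ Real.exp 1)
    (hμ : IsCapacityAchieving A lam μ) (h1 : 0 < moment lam μ 1) {x₀ : ℝ} (hx : x₀ ∈ Icc 0 A) :
    intensityInfo (fun y => Real.log (moment lam μ y)) (x₀ + lam) ≤ mutualInfo lam μ := by
  obtain ⟨hin, hcap⟩ := hμ
  have := hin.1
  have hmpos : ∀ y, 0 < moment lam μ y := fun y =>
    lt_of_lt_of_le (by have := moment_zero_pos lam hin; positivity)
      (moment_geometric_le hlam hin h1 y)
  obtain ⟨K, hg⟩ := exists_abs_log_moment_le hlam hAe hin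
  obtain ⟨Q, hQ⟩ := summable_sq_sub_div_moment hlam hAe hin h1 hx
  have hone : ∀ y : ℕ, |(fun _ => (1 : ℝ)) y| ≤ 1 * 1 ^ y := by simp
  have sm := hasSum_mul_moment hlam hAe hin hone
  have sw := hasSum_poissonMean hone (x₀ + lam)
  simp only [poissonMean_const, integral_const, probReal_univ, one_smul] at sm sw
  have sg := hasSum_poissonMean hg (x₀ + lam)
  have sφ := hasSum_moment_mul_log hlam hAe hin
  have key : ∀ ε ∈ Ioo (0 : ℝ) 1,
      intensityInfo (fun y => Real.log (moment lam μ y)) (x₀ + lam) - mutualInfo lam μ ≤ ε * Q := by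
    rintro ε ⟨hε0, hε1⟩
    have hmix := isInput_mixDirac hin hx hε0.le hε1.le
    have hle := mutualInfo_le_capacity hlam hAe hmix
    rw [← hcap] at hle
    have s := hasSum_moment_mul_log hlam hAe hmix
    rw [integral_mixDirac hin hε0.le hε1.le (continuous_energy lam)] at s
    have hs := hasSum_le (fun y => ?_) s ((((sφ.mul_left (1 - ε)).add (sg.mul_left ε)).add
      ((sw.sub sm).mul_left ε)).add (hQ.mul_left (ε ^ 2)))
    · unfold intensityInfo
      refine le_of_mul_le_mul_left ?_ hε0
      nlinarith
    · rw [moment_mixDirac hin hε0.le hε1.le]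
      have h := mul_log_mix_le (hmpos y) (weight_nonneg hlam hx.1 y) hε0.le hε1
      have hf : (0 : ℝ) ≤ (Nat.factorial y) := by positivity
      refine (div_le_div_of_nonneg_right h hf).trans (le_of_eq ?_)
      unfold weight
      ring
  have hlim : Filter.Tendsto (fun ε : ℝ => ε * Q) (nhdsWithin 0 (Ioi 0)) (nhds 0) := by
    have : Filter.Tendsto (fun ε : ℝ => ε * Q) (nhds 0) (nhds (0 * Q)) :=
      (continuous_mul_const Q).tendsto 0
    rw [zero_mul] at this
    exact this.mono_left nhdsWithin_le_nhds
  have := ge_of_tendsto hlim (Filter.mem_of_superset (Ioo_mem_nhdsGT one_pos) key)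
  linarith

lemma intensityInfo_eq_mutualInfo (hlam : 0 ≤ lam) (hAe : A + lam ≤ Real.exp 1)
    (hμ : IsCapacityAchieving A lam μ) (h1 : 0 < moment lam μ 1) {x₀ : ℝ} (hx : x₀ ∈ Icc 0 A)
    (hs : x₀ ∈ msupport μ) :
    intensityInfo (fun y => Real.log (moment lam μ y)) (x₀ + lam) = mutualInfo lam μ := by
  have hin := hμ.1
  have := hin.1
  obtain ⟨K, hg⟩ := exists_abs_log_moment_le hlam hAe hin
  set F := fun x => intensityInfo (fun y => Real.log (moment lam μ y)) (x + lam) with hF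
  have hFc : Continuous F :=
    (continuous_intensityInfo (by norm_num) hg).comp (continuous_add_const lam)
  refine le_antisymm (intensityInfo_le_mutualInfo hlam hAe hμ h1 hx) ?_
  by_contra! hlt
  have hpos := hs {x | F x < mutualInfo lam μ} (isOpen_lt hFc continuous_const) hlt
  have hnn : 0 ≤ᵐ[μ] fun x => mutualInfo lam μ - F x := hin.ae_mem.mono fun x hx =>
    sub_nonneg.2 (intensityInfo_le_mutualInfo hlam hAe hμ h1 hx)
  have hint : ∫ x, (mutualInfo lam μ - F x) ∂μ = 0 := by
    rw [integral_sub (integrable_const _) (hin.integrable hFc), hF,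
      ← mutualInfo_eq_integral hlam hAe hin]
    simp
  rw [integral_eq_zero_iff_of_nonneg_ae hnn (hin.integrable (continuous_const.sub hFc))] at hint
  refine hpos.ne' (measure_mono_null (fun x hx => ?_) (ae_iff.1 hint))
  simp only [mem_ofPred_eq, Pi.zero_apply] at hx ⊢
  linarith

lemma msupport_subset_Icc (hμ : IsInput A μ) : msupport μ ⊆ Icc 0 A := by
  intro x hx
  by_contra h
  exact (hx _ isClosed_Icc.isOpen_compl h).ne' hμ.2

lemma moment_one_pos_of_mem_msupport (hlam : 0 ≤ lam) (hμ : IsInput A μ) {x₀ : ℝ} (hx : 0 < x₀)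
    (hs : x₀ ∈ msupport μ) : 0 < moment lam μ 1 := by
  refine (moment_nonneg hlam hμ 1).lt_of_ne' fun h => ?_
  rw [moment_eq_zero_iff hlam hμ] at h
  refine (hs (Ioi 0) isOpen_Ioi hx).ne' (measure_mono_null (fun x hx => ?_) (ae_iff.1 h))
  intro hw
  have := (weight_eq_zero hw).1
  have : 0 < x := hx
  linarith

lemma msupport_subset_pair (hlam : 0 ≤ lam) (hAe : A + lam < Real.exp 1)
    (hμ : IsCapacityAchieving A lam μ) : msupport μ ⊆ {0, A} := by
  intro x hs
  have hx := msupport_subset_Icc hμ.1 hs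
  by_contra hne
  simp only [mem_insert_iff, mem_singleton_iff, not_or] at hne
  have hx0 : 0 < x := hx.1.lt_of_ne' hne.1
  have hxA : x < A := hx.2.lt_of_ne hne.2
  have h1 := moment_one_pos_of_mem_msupport hlam hμ.1 hx0 hs
  have hm0 := moment_zero_pos lam hμ.1
  obtain ⟨K, hg⟩ := exists_abs_log_moment_le hlam hAe.le hμ.1
  refine not_isLocalMax_intensityInfo (by norm_num) hg (b := A + lam) (t := x + lam) (fun y => ?_)
    (by linarith) hAe (by linarith) ?_
  · have hp : ∀ n, 0 < moment lam μ n := fun n =>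
      lt_of_lt_of_le (by positivity) (moment_geometric_le hlam hμ.1 h1 n)
    rw [← Real.log_div (hp _).ne' (hp _).ne']
    refine Real.log_le_log (div_pos (hp _) (hp _)) ?_
    rw [div_le_iff₀ (hp y)]
    exact moment_succ_le hlam hμ.1 y
  · have hmem : Ioo lam (A + lam) ∈ nhds (x + lam) :=
      Ioo_mem_nhds (by linarith) (by linarith)
    filter_upwards [hmem] with t ht
    rw [intensityInfo_eq_mutualInfo hlam hAe.le hμ h1 hx hs]
    have := intensityInfo_le_mutualInfo hlam hAe.le hμ h1 (x₀ := t - lam)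
      ⟨by linarith [ht.1], by linarith [ht.2]⟩
    rwa [sub_add_cancel] at this

lemma measure_compl_msupport (μ : Measure ℝ) : μ (msupport μ)ᶜ = 0 := by
  refine measure_null_of_locally_null _ fun x hx => ?_
  simp only [msupport, mem_compl_iff, mem_ofPred_eq, not_forall, not_lt, nonpos_iff_eq_zero] at hx
  obtain ⟨U, hU, hxU, h⟩ := hx
  exact ⟨U, mem_nhdsWithin_of_mem_nhds (hU.mem_nhds hxU), h⟩

lemma not_msupport_subset_singleton (hA : 0 < A) (hlam : 0 ≤ lam) (hAe : A + lam ≤ Real.exp 1)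
    (hμ : IsCapacityAchieving A lam μ) (x : ℝ) : ¬ msupport μ ⊆ {x} := by
  intro h
  have := hμ.1.1
  have hae : ∀ᵐ y ∂μ, y ∈ ({x} : Set ℝ) :=
    measure_mono_null (compl_subset_compl.2 h) (measure_compl_msupport μ)
  have hd : μ = Measure.dirac x := by
    have h1 : μ {x} = 1 := prob_compl_eq_zero_iff (measurableSet_singleton x) |>.1 hae
    rw [← Measure.restrict_eq_self_of_ae_mem hae, Measure.restrict_singleton, h1, one_smul]
  have hcap := hμ.2
  rw [hd, mutualInfo_dirac] at hcap
  exact (capacity_pos hA hlam hAe).ne hcap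

end Capacity

/-- For `A + lam < e` the optimal input has exactly two support points, `0` and `A`. -/
theorem support_eq_pair_of_small (A lam : ℝ) (hA : 0 < A) (hlam : 0 ≤ lam)
    (hAe : A + lam < Real.exp 1)
    (μ : Measure ℝ) (hμ : IsCapacityAchieving A lam μ) :
    msupport μ = {0, A} := by
  have hsub := msupport_subset_pair hlam hAe hμ
  refine hsub.antisymm (insert_subset ?_ (singleton_subset_iff.2 ?_))
  · by_contra h
    refine not_msupport_subset_singleton hA hlam hAe.le hμ A fun x hx => ?_
    exact (hsub hx).resolve_left fun h0 => h (h0 ▸ hx)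
  · by_contra h
    refine not_msupport_subset_singleton hA hlam hAe.le hμ 0 fun x hx => ?_
    exact (hsub hx).resolve_right fun h0 => h ((mem_singleton_iff.1 h0) ▸ hx)
end
end

section
/- Let λ ≥ 0 and let c : ℕ → ℝ be a bounded sequence. Define h(x) = Σ_{y=0}^∞ ((x+λ)^y / y!) e^{-(x+λ)} c(y). Then for every x > −λ, h is differentiable at x and h'(x) = Σ_{y=0}^∞ ((x+λ)^y / y!) e^{-(x+λ)} (c(y+1) − c(y)). Equivalently, if Y given X = x is Poisson with mean x + λ and f : ℕ → ℝ is bounded, then (d/dx) E[f(Y) | X = x] = E[f(Y+1) − f(Y) | X = x]. -/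
open Real

/-- An exponential series with bounded coefficients converges. -/
theorem summable_pow_div_factorial_mul {c : ℕ → ℝ} {L : ℝ} (hc : ∀ y, |c y| ≤ L) (z : ℝ) :
    Summable fun y : ℕ => z ^ y / (Nat.factorial y : ℝ) * c y := by
  refine Summable.of_norm_bounded ((Real.summable_pow_div_factorial |z|).mul_right L) fun y => ?_
  rw [Real.norm_eq_abs, abs_mul, abs_div, abs_pow, Nat.abs_cast]
  gcongr
  exact hc y

/-- Differentiating an exponential series with bounded coefficients shifts the coefficients. -/
theorem hasDerivAt_tsum_pow_div_factorial_mul {c : ℕ → ℝ} {L : ℝ} (hc : ∀ y, |c y| ≤ L) (z : ℝ) :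
    HasDerivAt (fun u : ℝ => ∑' y : ℕ, u ^ y / (Nat.factorial y : ℝ) * c y)
      (∑' y : ℕ, z ^ y / (Nat.factorial y : ℝ) * c (y + 1)) z := by
  have shift (v a : ℝ) (y : ℕ) :
      ((y + 1 : ℕ) : ℝ) * v ^ (y + 1 - 1) / (Nat.factorial (y + 1) : ℝ) * a =
        v ^ y / (Nat.factorial y : ℝ) * a := by
    rw [Nat.factorial_succ, Nat.add_sub_cancel, Nat.cast_mul,
      mul_div_mul_left _ _ (Nat.cast_ne_zero.mpr y.succ_ne_zero)]
  set R : ℝ := |z| + 1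
  have hzR : z ∈ Metric.ball (0 : ℝ) R := by
    rw [mem_ball_zero_iff, Real.norm_eq_abs]
    exact lt_add_one _
  have hbound : Summable fun y : ℕ => (y : ℝ) * R ^ (y - 1) / (Nat.factorial y : ℝ) * L := by
    rw [← summable_nat_add_iff 1]
    simp only [shift]
    exact (Real.summable_pow_div_factorial R).mul_right L
  have hbd (y : ℕ) (v : ℝ) (hv : v ∈ Metric.ball (0 : ℝ) R) :
      ‖(y : ℝ) * v ^ (y - 1) / (Nat.factorial y : ℝ) * c y‖ ≤
        (y : ℝ) * R ^ (y - 1) / (Nat.factorial y : ℝ) * L := by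
    rw [mem_ball_zero_iff, Real.norm_eq_abs] at hv
    rw [Real.norm_eq_abs, abs_mul, abs_div, abs_mul, abs_pow, Nat.abs_cast, Nat.abs_cast]
    gcongr
    exact hc y
  have hderiv := hasDerivAt_tsum_of_isPreconnected hbound Metric.isOpen_ball
    (convex_ball (0 : ℝ) R).isPreconnected
    (fun y v _ => ((hasDerivAt_pow y v).div_const (Nat.factorial y : ℝ)).mul_const (c y))
    hbd hzR (summable_pow_div_factorial_mul hc z) hzR
  convert! hderiv using 1
  rw [(Summable.of_norm_bounded hbound fun y => hbd y z hzR).tsum_eq_zero_add]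
  simp only [shift, Nat.cast_zero, zero_mul, zero_div, zero_add]

/-- Derivative identity for Poisson expectations: if `Y | X = x` is Poisson with mean
`x + lam` and `c` is bounded, then `(d/dx) E[c(Y)|X=x] = E[c(Y+1) - c(Y)|X=x]`. -/
theorem poisson_expectation_hasDerivAt (lam : ℝ) (hlam : 0 ≤ lam)
    (c : ℕ → ℝ) (L : ℝ) (hc : ∀ y, |c y| ≤ L)
    (x : ℝ) (hx : -lam < x) :
    HasDerivAt
      (fun u => ∑' y : ℕ, (u + lam) ^ y / (Nat.factorial y : ℝ) * Real.exp (-(u + lam)) * c y)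
      (∑' y : ℕ, (x + lam) ^ y / (Nat.factorial y : ℝ) * Real.exp (-(x + lam)) *
        (c (y + 1) - c y)) x := by
  have hsum := (hasDerivAt_tsum_pow_div_factorial_mul hc (x + lam)).comp_add_const x lam
  have hexp : HasDerivAt (fun u : ℝ => Real.exp (-(u + lam))) (-Real.exp (-(x + lam))) x := by
    simpa using ((hasDerivAt_id x).add_const lam).neg.exp
  convert! hsum.mul hexp using 1
  · funext u
    rw [Pi.mul_apply, ← tsum_mul_right]
    exact tsum_congr fun y => by ring
  · rw [mul_neg, ← sub_eq_add_neg, ← sub_mul,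
      ← (summable_pow_div_factorial_mul (fun y => hc (y + 1)) _).tsum_sub
        (summable_pow_div_factorial_mul hc _), ← tsum_mul_right]
    exact tsum_congr fun y => by ring
end

section
/- Let A > 0, λ > 0, and let X be a real random variable with 0 ≤ X ≤ A almost surely. Set m_y := E[(X+λ)^y e^{-(X+λ)}] for y ∈ ℕ (note m_y > 0 for all y). Then for every y ∈ ℕ, m_{y+1}² / (m_y · m_{y+2}) ≥ λ/(A+λ); equivalently, (κ₁(X|Y=y)+λ)/(κ₁(X|Y=y+1)+λ) ≥ λ/(A+λ). -/
open MeasureTheory Real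

/-- Exponentially weighted powers of an almost surely bounded variable are integrable. -/
theorem integrable_pow_mul_exp_neg_of_mem_Icc {Ω : Type*} [MeasurableSpace Ω]
    {P : Measure Ω} [IsFiniteMeasure P] {a b : ℝ} (ha : 0 ≤ a) {Z : Ω → ℝ}
    (hZ : Measurable Z) (hZmem : ∀ᵐ ω ∂P, Z ω ∈ Set.Icc a b) (k : ℕ) :
    Integrable (fun ω => Z ω ^ k * Real.exp (-Z ω)) P := by
  refine Integrable.of_bound (by fun_prop) (b ^ k) ?_
  filter_upwards [hZmem] with ω ⟨h1, h2⟩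
  have h0 : 0 ≤ Z ω := ha.trans h1
  rw [Real.norm_of_nonneg (by positivity)]
  have hexp : Real.exp (-Z ω) ≤ 1 := Real.exp_le_one_iff.2 (by linarith)
  exact (mul_le_of_le_one_right (by positivity) hexp).trans (by gcongr)

theorem integral_pow_mul_exp_neg_pos {Ω : Type*} [MeasurableSpace Ω]
    {P : Measure Ω} [IsProbabilityMeasure P] {a b : ℝ} (ha : 0 < a) {Z : Ω → ℝ}
    (hZ : Measurable Z) (hZmem : ∀ᵐ ω ∂P, Z ω ∈ Set.Icc a b) (k : ℕ) :
    0 < ∫ ω, Z ω ^ k * Real.exp (-Z ω) ∂P := by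
  have hc : 0 < a ^ k * Real.exp (-b) := by positivity
  calc 0 < ∫ _, a ^ k * Real.exp (-b) ∂P := by simpa using hc
    _ ≤ _ := by
      refine integral_mono_ae (integrable_const _)
        (integrable_pow_mul_exp_neg_of_mem_Icc ha.le hZ hZmem k) ?_
      filter_upwards [hZmem] with ω ⟨h1, h2⟩
      have h0 : 0 < Z ω := ha.trans_le h1
      gcongr

theorem mul_integral_pow_mul_exp_neg_le_succ {Ω : Type*} [MeasurableSpace Ω]
    {P : Measure Ω} [IsFiniteMeasure P] {a b : ℝ} (ha : 0 ≤ a) {Z : Ω → ℝ}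
    (hZ : Measurable Z) (hZmem : ∀ᵐ ω ∂P, Z ω ∈ Set.Icc a b) (k : ℕ) :
    a * ∫ ω, Z ω ^ k * Real.exp (-Z ω) ∂P ≤ ∫ ω, Z ω ^ (k + 1) * Real.exp (-Z ω) ∂P := by
  have hint := integrable_pow_mul_exp_neg_of_mem_Icc ha hZ hZmem
  rw [← integral_const_mul]
  refine integral_mono_ae ((hint k).const_mul _) (hint (k + 1)) ?_
  filter_upwards [hZmem] with ω ⟨h1, _⟩
  have h0 : 0 ≤ Z ω := ha.trans h1
  rw [pow_succ', mul_assoc]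
  gcongr

theorem integral_pow_succ_mul_exp_neg_le_mul {Ω : Type*} [MeasurableSpace Ω]
    {P : Measure Ω} [IsFiniteMeasure P] {a b : ℝ} (ha : 0 ≤ a) {Z : Ω → ℝ}
    (hZ : Measurable Z) (hZmem : ∀ᵐ ω ∂P, Z ω ∈ Set.Icc a b) (k : ℕ) :
    ∫ ω, Z ω ^ (k + 1) * Real.exp (-Z ω) ∂P ≤ b * ∫ ω, Z ω ^ k * Real.exp (-Z ω) ∂P := by
  have hint := integrable_pow_mul_exp_neg_of_mem_Icc ha hZ hZmem
  rw [← integral_const_mul]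
  refine integral_mono_ae (hint (k + 1)) ((hint k).const_mul _) ?_
  filter_upwards [hZmem] with ω ⟨h1, h2⟩
  have h0 : 0 ≤ Z ω := ha.trans h1
  rw [pow_succ', mul_assoc]
  gcongr

/-- Lower bound on the ratio of conditional cumulants, positive dark current:
with `m_y = E[(X+lam)^y e^{-(X+lam)}]`, one has
`(κ₁(X|Y=y)+lam)/(κ₁(X|Y=y+1)+lam) = m_{y+1}²/(m_y m_{y+2}) ≥ lam/(A+lam)`. -/
theorem cumulant_ratio_lower_bound {Ω : Type*} [MeasurableSpace Ω]
    (P : Measure Ω) [IsProbabilityMeasure P]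
    (A lam : ℝ) (hA : 0 < A) (hlam : 0 < lam)
    (X : Ω → ℝ) (hX : Measurable X) (hXmem : ∀ᵐ ω ∂P, X ω ∈ Set.Icc 0 A)
    (y : ℕ) :
    lam / (A + lam) ≤
      (∫ ω, (X ω + lam) ^ (y + 1) * Real.exp (-(X ω + lam)) ∂P) ^ 2 /
        ((∫ ω, (X ω + lam) ^ y * Real.exp (-(X ω + lam)) ∂P) *
          (∫ ω, (X ω + lam) ^ (y + 2) * Real.exp (-(X ω + lam)) ∂P)) := by
  have hZ : Measurable fun ω => X ω + lam := hX.add_const lam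
  have hZmem : ∀ᵐ ω ∂P, X ω + lam ∈ Set.Icc lam (A + lam) := by
    filter_upwards [hXmem] with ω ⟨h1, h2⟩
    exact ⟨by linarith, by linarith⟩
  have hpos := integral_pow_mul_exp_neg_pos hlam hZ hZmem
  have hlow := mul_integral_pow_mul_exp_neg_le_succ hlam.le hZ hZmem y
  have hupp := integral_pow_succ_mul_exp_neg_le_mul hlam.le hZ hZmem (y + 1)
  rw [div_le_div_iff₀ (by positivity) (mul_pos (hpos y) (hpos (y + 2)))]
  have hmul := mul_le_mul hlow hupp (hpos (y + 2)).le (hpos (y + 1)).le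
  linarith
end

section
/- Let A > 0, L > 0, and let c : ℕ → ℝ satisfy |c(y)| ≤ L for all y. Define the entire function ğ(z) = 1 + z · Σ_{y=0}^∞ (z^y / y!) e^{-z} c(y) for z ∈ ℂ. Then the set of zeros of ğ in the closed disk {z : |z| ≤ A} is finite and its cardinality is at most log(1 + A e^{2eA+1} L). -/
open Metric

/-- A finite set of zeros of an entire function can be factored out. -/
theorem Differentiable.exists_eq_prod_sub_mul {f : ℂ → ℂ} (hf : Differentiable ℂ f)
    (S : Finset ℂ) (hS : ∀ a ∈ S, f a = 0) :
    ∃ h : ℂ → ℂ, Differentiable ℂ h ∧ ∀ z, f z = (∏ a ∈ S, (z - a)) * h z := by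
  induction S using Finset.induction_on with
  | empty => exact ⟨f, hf, by simp⟩
  | insert b S hb ih =>
    obtain ⟨h, hh, hfh⟩ := ih fun a ha => hS a (Finset.mem_insert_of_mem ha)
    have hhb : h b = 0 := by
      have h0 := hfh b
      rw [hS b (Finset.mem_insert_self b S), eq_comm, mul_eq_zero] at h0
      refine h0.resolve_left (Finset.prod_ne_zero_iff.2 fun a ha => sub_ne_zero.2 ?_)
      rintro rfl
      exact hb ha
    refine ⟨dslope h b, ?_, fun z => ?_⟩
    · rw [← differentiableOn_univ] at hh ⊢
      exact (Complex.differentiableOn_dslope Filter.univ_mem).2 hh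
    · have h1 := sub_smul_dslope h b z
      rw [hhb, sub_zero, smul_eq_mul] at h1
      rw [hfh z, Finset.prod_insert hb, ← h1]
      ring

/-- On the circle of radius `R`, the Blaschke factor of the disk of radius `R` has norm one. -/
theorem Complex.norm_sq_sub_conj_mul_div {R : ℝ} (hR : 0 < R) {z : ℂ} (hz : ‖z‖ = R) (a : ℂ) :
    ‖((R : ℂ) ^ 2 - (starRingEnd ℂ) a * z) / R‖ = ‖z - a‖ := by
  have h1 : (R : ℂ) ^ 2 - (starRingEnd ℂ) a * z = z * (starRingEnd ℂ) (z - a) := by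
    rw [map_sub, mul_sub, Complex.mul_conj, Complex.normSq_eq_norm_sq, hz]
    push_cast
    ring
  rw [h1, norm_div, norm_mul, Complex.norm_conj, hz, Complex.norm_real, Real.norm_eq_abs,
    abs_of_pos hR]
  field_simp

/-- Jensen's bound for the number of zeros of an entire function in a disk. -/
theorem Differentiable.norm_mul_pow_card_zeros_le {f : ℂ → ℂ} (hf : Differentiable ℂ f)
    {r R M : ℝ} (hr : 0 < r) (hR : 0 < R) (hM : ∀ z, ‖z‖ = R → ‖f z‖ ≤ M)
    (S : Finset ℂ) (hS : ∀ a ∈ S, f a = 0) (hSr : ∀ a ∈ S, ‖a‖ ≤ r) :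
    ‖f 0‖ * (R / r) ^ S.card ≤ M := by
  obtain ⟨h, hh, hfh⟩ := hf.exists_eq_prod_sub_mul S hS
  let F : ℂ → ℂ := fun z => (∏ a ∈ S, ((R : ℂ) ^ 2 - (starRingEnd ℂ) a * z) / R) * h z
  have hF : Differentiable ℂ F := by
    refine Differentiable.mul (Differentiable.fun_finsetProd fun a _ => ?_) hh
    fun_prop
  have hFM : ‖F 0‖ ≤ M := by
    refine Complex.norm_le_of_forall_mem_frontier_norm_le (U := ball 0 R) isBounded_ball
      hF.diffContOnCl (fun z hz => ?_) (subset_closure (mem_ball_self hR))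
    rw [frontier_ball _ hR.ne', mem_sphere_zero_iff_norm] at hz
    refine le_trans (le_of_eq ?_) (hM z hz)
    simp only [F, hfh z, norm_mul, norm_prod, Complex.norm_sq_sub_conj_mul_div hR hz]
  have hF0 : ‖F 0‖ = R ^ S.card * ‖h 0‖ := by
    have hR' : (R : ℂ) ≠ 0 := by exact_mod_cast hR.ne'
    have h2 : (R : ℂ) ^ 2 / R = R := by field_simp
    simp only [F, mul_zero, sub_zero, h2, Finset.prod_const, norm_mul, norm_pow,
      Complex.norm_real, Real.norm_eq_abs, abs_of_pos hR]
  have hf0 : ‖f 0‖ ≤ r ^ S.card * ‖h 0‖ := by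
    rw [hfh 0, norm_mul, norm_prod]
    gcongr
    rw [← Finset.prod_const]
    exact Finset.prod_le_prod (fun _ _ => norm_nonneg _) fun a ha => by simpa using hSr a ha
  calc ‖f 0‖ * (R / r) ^ S.card ≤ r ^ S.card * ‖h 0‖ * (R / r) ^ S.card := by gcongr
    _ = ‖F 0‖ := by
      rw [hF0, div_pow]
      field_simp
    _ ≤ M := hFM

theorem norm_pow_div_factorial_mul_exp_neg_mul_le {L R : ℝ} {c : ℕ → ℝ} (hc : ∀ y, |c y| ≤ L)
    {z : ℂ} (hz : ‖z‖ ≤ R) (y : ℕ) :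
    ‖z ^ y / (Nat.factorial y : ℂ) * Complex.exp (-z) * (c y : ℂ)‖ ≤
      R ^ y / (Nat.factorial y : ℝ) * (Real.exp R * L) := by
  have hR : 0 ≤ R := (norm_nonneg z).trans hz
  have hexp : ‖Complex.exp (-z)‖ ≤ Real.exp R := by
    rw [Complex.norm_exp]
    exact Real.exp_le_exp.2 ((Complex.re_le_norm _).trans (by rwa [norm_neg]))
  rw [norm_mul, norm_mul, norm_div, norm_pow, Complex.norm_natCast, Complex.norm_real,
    Real.norm_eq_abs, mul_assoc]
  gcongr
  exact hc y

theorem hasSum_pow_div_factorial_mul (R K : ℝ) :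
    HasSum (fun y : ℕ => R ^ y / (Nat.factorial y : ℝ) * K) (Real.exp R * K) := by
  have h := NormedSpace.expSeries_div_hasSum_exp R
  rw [← Real.exp_eq_exp_ℝ] at h
  exact h.mul_right K

theorem differentiable_tsum_pow_div_factorial_mul_exp_neg {L : ℝ} {c : ℕ → ℝ}
    (hc : ∀ y, |c y| ≤ L) :
    Differentiable ℂ fun z : ℂ =>
      ∑' y : ℕ, z ^ y / (Nat.factorial y : ℂ) * Complex.exp (-z) * (c y : ℂ) := by
  intro z
  have hz : z ∈ ball (0 : ℂ) (‖z‖ + 1) := by simp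
  refine (Complex.differentiableOn_tsum_of_summable_norm
    (hasSum_pow_div_factorial_mul (‖z‖ + 1) _).summable (fun y => ?_) isOpen_ball
    fun y w hw => norm_pow_div_factorial_mul_exp_neg_mul_le hc
      (mem_ball_zero_iff.1 hw).le y).differentiableAt (isOpen_ball.mem_nhds hz)
  fun_prop

/-- The entire function `ğ(z) = 1 + z Σ_y (z^y / y!) e^{-z} c(y)`, with `|c| ≤ L`, has
finitely many zeros in the closed disk `|z| ≤ A`, at most `log(1 + A e^{2eA+1} L)` many. -/
theorem zeros_bound_analytic_extension (A L : ℝ) (hA : 0 < A) (hL : 0 < L)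
    (c : ℕ → ℝ) (hc : ∀ y, |c y| ≤ L) :
    ({z ∈ closedBall (0 : ℂ) A |
        1 + z * ∑' y : ℕ, z ^ y / (Nat.factorial y : ℂ) * Complex.exp (-z) * (c y : ℂ)
          = 0}).Finite ∧
      (({z ∈ closedBall (0 : ℂ) A |
          1 + z * ∑' y : ℕ, z ^ y / (Nat.factorial y : ℂ) * Complex.exp (-z) * (c y : ℂ)
            = 0}).ncard : ℝ) ≤
        Real.log (1 + A * Real.exp (2 * Real.exp 1 * A + 1) * L) := by
  set g : ℂ → ℂ := fun z =>
    1 + z * ∑' y : ℕ, z ^ y / (Nat.factorial y : ℂ) * Complex.exp (-z) * (c y : ℂ) with hg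
  set M : ℝ := 1 + A * Real.exp (2 * Real.exp 1 * A + 1) * L with hM
  have hM0 : 0 < M := by positivity
  have hgd : Differentiable ℂ g :=
    (differentiable_id.mul (differentiable_tsum_pow_div_factorial_mul_exp_neg hc)).const_add 1
  have hbound : ∀ z : ℂ, ‖z‖ = Real.exp 1 * A → ‖g z‖ ≤ M := by
    intro z hz
    have hsum := tsum_of_norm_bounded (hasSum_pow_div_factorial_mul (Real.exp 1 * A) _)
      (norm_pow_div_factorial_mul_exp_neg_mul_le hc hz.le)
    calc ‖g z‖ ≤ ‖(1 : ℂ)‖ + ‖z‖ * ‖∑' y : ℕ,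
          z ^ y / (Nat.factorial y : ℂ) * Complex.exp (-z) * (c y : ℂ)‖ := by
          rw [← norm_mul]
          exact norm_add_le _ _
      _ ≤ 1 + Real.exp 1 * A *
          (Real.exp (Real.exp 1 * A) * (Real.exp (Real.exp 1 * A) * L)) := by
          rw [hz, norm_one]
          gcongr
      _ = M := by
          rw [hM, Real.exp_add, show 2 * Real.exp 1 * A = Real.exp 1 * A + Real.exp 1 * A by ring,
            Real.exp_add]
          ring
  have hcard : ∀ S : Finset ℂ, (S : Set ℂ) ⊆ {z ∈ closedBall (0 : ℂ) A | g z = 0} →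
      (S.card : ℝ) ≤ Real.log M := by
    intro S hS
    have h1 := hgd.norm_mul_pow_card_zeros_le hA (by positivity) hbound S
      (fun a ha => (hS ha).2) (fun a ha => mem_closedBall_zero_iff.1 (hS ha).1)
    rw [mul_div_cancel_right₀ _ hA.ne', show g 0 = 1 by simp [hg], norm_one, one_mul,
      ← Real.exp_nat_mul, mul_one] at h1
    exact (Real.le_log_iff_exp_le hM0).2 h1
  have hfin : {z ∈ closedBall (0 : ℂ) A | g z = 0}.Finite := by
    by_contra hinf
    obtain ⟨S, hS, hSc⟩ := Set.Infinite.exists_subset_card_eq hinf (⌊Real.log M⌋₊ + 1)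
    have h1 := hcard S hS
    rw [hSc] at h1
    push_cast at h1
    exact absurd h1 (Nat.lt_floor_add_one _).not_ge
  refine ⟨hfin, ?_⟩
  rw [Set.ncard_eq_toFinset_card _ hfin]
  exact hcard _ (by simp)
end

section
/- Let s ≥ e and let x > 0 satisfy log(x/s) + 1/x ≤ 0. Then e^{−√(2(log s − 1))} ≤ x ≤ s − 1. -/
/-- If `s ≥ e` and `x > 0` satisfies `log(x/s) + 1/x ≤ 0`, then
`e^{-√(2(log s - 1))} ≤ x ≤ s - 1`. -/
theorem interior_point_localization (s x : ℝ) (hs : Real.exp 1 ≤ s) (hx : 0 < x)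
    (h : Real.log (x / s) + 1 / x ≤ 0) :
    Real.exp (-Real.sqrt (2 * (Real.log s - 1))) ≤ x ∧ x ≤ s - 1 := by
  have hs0 : 0 < s := (Real.exp_pos 1).trans_le hs
  rw [Real.log_div hx.ne' hs0.ne'] at h
  constructor
  · rw [← Real.le_log_iff_exp_le hx]
    rcases le_total 0 (Real.log x) with ht | ht
    · linarith [Real.sqrt_nonneg (2 * (Real.log s - 1))]
    · have hexp := Real.quadratic_le_exp_of_nonneg (neg_nonneg.2 ht)
      rw [Real.exp_neg, Real.exp_log hx, ← one_div] at hexp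
      have hle : -Real.log x ≤ Real.sqrt (2 * (Real.log s - 1)) :=
        Real.le_sqrt_of_sq_le (by linarith)
      linarith
  · have hlog := Real.log_le_sub_one_of_pos (div_pos hs0 hx)
    rw [Real.log_div hs0.ne' hx.ne'] at hlog
    have hdiv : (1 + x) / x ≤ s / x := by
      rw [add_div, div_self hx.ne']
      linarith
    linarith [(div_le_div_iff_of_pos_right hx).1 hdiv]
end
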